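/- arXiv:1704.02912 — 2 statements merged into one kernel-verified Lean document; each statement's English description precedes it below -/
import Mathlib

section
/- Let d ∈ {1,2,3}, α ∈ (0, 2/d), θ ∈ (π/2, π), c > 0, and let (λ_j)_{j≥1} be positive reals with λ_j ≥ c j^{2/d} for all j ≥ 1. Define S(r) := ∑_{j=1}^∞ ( r^α/(r^α + λ_j) )² for r > 0. Then there exists a constant C > 0, independent of τ, t, and κ, such that for all τ > 0, all t ≥ τ, and all κ ∈ (0, 2/(t·sin θ)]: τ ∫₀^t [ 2 ∫_κ^{π/(τ sin θ)} S(r) e^{2 s r cos θ} dr + κ ∫_{−θ}^{θ} S(κ) e^{2 s κ cos ψ} dψ ] ds ≤ C τ^{1 − α d/2}. -/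
open Real MeasureTheory intervalIntegral

/-- For integrals over `[a, b]`, domination of a nonnegative function gives an upper bound without
any integrability assumption on the dominated function. -/
lemma intervalIntegral_mono_of_nonneg {f g : ℝ → ℝ} {a b : ℝ} (hab : a ≤ b)
    (hf : ∀ x ∈ Set.Ioc a b, 0 ≤ f x) (hfg : ∀ x ∈ Set.Ioc a b, f x ≤ g x)
    (hg : IntervalIntegrable g volume a b) :
    ∫ x in a..b, f x ≤ ∫ x in a..b, g x := by
  rw [integral_of_le hab, integral_of_le hab]
  exact integral_mono_of_nonneg ((ae_restrict_iff' measurableSet_Ioc).2 (ae_of_all _ hf))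
    ((intervalIntegrable_iff_integrableOn_Ioc_of_le hab).1 hg)
    ((ae_restrict_iff' measurableSet_Ioc).2 (ae_of_all _ hfg))

lemma integrableOn_inv_one_add_mul_rpow_sq {p c : ℝ} (hp : 1 / 2 < p) (hc : 0 < c) :
    IntegrableOn (fun v : ℝ => ((1 + c * v ^ p)⁻¹) ^ 2) (Set.Ioi 0) := by
  have hmeas : Measurable (fun v : ℝ => ((1 + c * v ^ p)⁻¹) ^ 2) := by fun_prop
  rw [← Set.Ioc_union_Ioi_eq_Ioi (zero_le_one' ℝ)]
  refine IntegrableOn.union ?_ ?_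
  · refine Measure.integrableOn_of_bounded (M := 1) (by simp) hmeas.aestronglyMeasurable ?_
    refine (ae_restrict_iff' measurableSet_Ioc).2 (ae_of_all _ fun v hv => ?_)
    have hv0 : 0 ≤ c * v ^ p := mul_nonneg hc.le (rpow_nonneg hv.1.le p)
    rw [Real.norm_of_nonneg (by positivity)]
    exact pow_le_one₀ (by positivity) (inv_le_one_of_one_le₀ (by linarith))
  · refine Integrable.mono' (g := fun v : ℝ => (c⁻¹) ^ 2 * v ^ (-2 * p))
      ((integrableOn_Ioi_rpow_of_lt (by linarith) one_pos).const_mul _)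
      hmeas.aestronglyMeasurable ?_
    refine (ae_restrict_iff' measurableSet_Ioi).2 (ae_of_all _ fun v (hv : 1 < v) => ?_)
    have hv0 : 0 < v := by linarith
    have hvp : 0 < v ^ p := rpow_pos_of_pos hv0 p
    have hpow : v ^ (-2 * p) = ((v ^ p)⁻¹) ^ 2 := by
      rw [← rpow_neg hv0.le, ← rpow_natCast, ← rpow_mul hv0.le]
      congr 1
      push_cast
      ring
    rw [Real.norm_of_nonneg (by positivity), hpow, ← mul_pow, ← mul_inv]
    gcongr
    linarith

/-- If `μ j ≥ c (j + 1) ^ p` with `p > 1 / 2`, the sum of `(y ^ p / (y ^ p + μ j)) ^ 2` grows at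
most linearly in `y`. -/
lemma exists_tsum_sq_le_mul {p c : ℝ} (hp : 1 / 2 < p) (hc : 0 < c) {μ : ℕ → ℝ}
    (hμ : ∀ j : ℕ, c * ((j : ℝ) + 1) ^ p ≤ μ j) :
    ∃ A : ℝ, 0 < A ∧ ∀ y : ℝ, 0 < y → ∑' j : ℕ, (y ^ p / (y ^ p + μ j)) ^ 2 ≤ A * y := by
  have hint := integrableOn_inv_one_add_mul_rpow_sq hp hc
  set g : ℝ → ℝ := fun v => ((1 + c * v ^ p)⁻¹) ^ 2 with hg
  have hg0 : ∀ v, 0 ≤ g v := fun v => sq_nonneg _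
  have hI : 0 ≤ ∫ v in Set.Ioi 0, g v := integral_nonneg hg0
  refine ⟨(∫ v in Set.Ioi 0, g v) + 1, by linarith, fun y hy => ?_⟩
  refine Real.tsum_le_of_sum_range_le (fun _ => sq_nonneg _) fun n => ?_
  have hterm : ∀ j : ℕ, (y ^ p / (y ^ p + μ j)) ^ 2 ≤ g ((0 + ((j + 1 : ℕ) : ℝ)) / y) := by
    intro j
    have hyp : 0 < y ^ p := rpow_pos_of_pos hy p
    have hj : 0 < ((j : ℝ) + 1) ^ p := by positivity
    have hμj := hμ j
    have hcj : 0 < c * ((j : ℝ) + 1) ^ p := by positivity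
    have heq : (1 + c * ((0 + ((j + 1 : ℕ) : ℝ)) / y) ^ p)⁻¹
        = y ^ p / (y ^ p + c * ((j : ℝ) + 1) ^ p) := by
      push_cast
      rw [zero_add, div_rpow (by positivity) hy.le]
      field_simp
    simp only [hg, heq]
    have hden : 0 < y ^ p + μ j := by linarith
    gcongr
  have hanti : AntitoneOn (fun u => g (u / y)) (Set.Icc (0 : ℝ) (0 + (n : ℝ))) := by
    intro u hu v hv huv
    have hu0 : 0 ≤ u / y := div_nonneg hu.1 hy.le
    have hp0 : 0 ≤ p := by linarith
    have h1 : 0 ≤ (u / y) ^ p := rpow_nonneg hu0 p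
    simp only [hg]
    have hv0 : 0 ≤ (v / y) ^ p := rpow_nonneg (div_nonneg hv.1 hy.le) p
    gcongr
  calc ∑ j ∈ Finset.range n, (y ^ p / (y ^ p + μ j)) ^ 2
      ≤ ∑ j ∈ Finset.range n, g ((0 + ((j + 1 : ℕ) : ℝ)) / y) :=
        Finset.sum_le_sum fun j _ => hterm j
    _ ≤ ∫ u in (0 : ℝ)..0 + (n : ℝ), g (u / y) := hanti.sum_le_integral
    _ = y * ∫ v in (0 : ℝ)..(n : ℝ) / y, g v := by
        rw [integral_comp_div _ hy.ne', smul_eq_mul]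
        simp
    _ ≤ y * ∫ v in Set.Ioi 0, g v := by
        rw [integral_of_le (by positivity)]
        exact mul_le_mul_of_nonneg_left (setIntegral_mono_set hint (ae_of_all _ hg0)
          Set.Ioc_subset_Ioi_self.eventuallyLE) hy.le
    _ ≤ ((∫ v in Set.Ioi 0, g v) + 1) * y := by nlinarith

lemma integral_exp_neg_mul_le {a t : ℝ} (ha : 0 < a) :
    ∫ s in (0 : ℝ)..t, Real.exp (-a * s) ≤ a⁻¹ := by
  rw [integral_comp_mul_left (fun x => Real.exp x) (neg_ne_zero.2 ha.ne'), integral_exp,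
    smul_eq_mul, mul_zero, Real.exp_zero, inv_neg]
  have := Real.exp_pos (-a * t)
  have := inv_pos.2 ha
  nlinarith

/-- The contribution of the two rays of the contour. -/
lemma integral_integral_rpow_mul_exp_le {β b κ R t : ℝ} (hβ : 0 < β) (hb : 0 < b) (hκ : 0 < κ)
    (hκR : κ ≤ R) (ht : 0 ≤ t) :
    ∫ s in (0 : ℝ)..t, ∫ r in κ..R, r ^ β * Real.exp (2 * s * r * -b) ≤ R ^ β / (2 * b * β) := by
  have hcont : Continuous (Function.uncurry
      fun s r : ℝ => r ^ β * Real.exp (2 * s * r * -b)) := by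
    have : Continuous fun q : ℝ × ℝ => q.2 ^ β := continuous_snd.rpow_const fun _ => Or.inr hβ.le
    simp only [Function.uncurry_def]
    fun_prop
  rw [intervalIntegral_intervalIntegral_swap]
  · calc ∫ r in κ..R, ∫ s in (0 : ℝ)..t, r ^ β * Real.exp (2 * s * r * -b)
        ≤ ∫ r in κ..R, (2 * b)⁻¹ * r ^ (β - 1) := by
          refine intervalIntegral_mono_of_nonneg hκR (fun r hr => ?_) (fun r hr => ?_) ?_
          · have hr0 : 0 ≤ r := (hκ.trans hr.1).le
            exact integral_nonneg ht fun s _ => by positivity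
          · have hr0 : 0 < r := hκ.trans hr.1
            have h := integral_exp_neg_mul_le (a := 2 * b * r) (t := t) (by positivity)
            rw [intervalIntegral.integral_const_mul, rpow_sub_one hr0.ne']
            have hcongr : ∀ s : ℝ, 2 * s * r * -b = -(2 * b * r) * s := fun s => by ring
            simp only [hcongr]
            calc r ^ β * ∫ s in (0 : ℝ)..t, Real.exp (-(2 * b * r) * s)
                ≤ r ^ β * (2 * b * r)⁻¹ := by gcongr
              _ = (2 * b)⁻¹ * (r ^ β / r) := by rw [mul_inv]; ring
          · exact (intervalIntegrable_rpow' (by linarith)).const_mul _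
      _ = (2 * b)⁻¹ * ((R ^ β - κ ^ β) / β) := by
          rw [intervalIntegral.integral_const_mul, integral_rpow (Or.inl (by linarith))]
          simp
      _ ≤ R ^ β / (2 * b * β) := by
          rw [inv_mul_eq_div, div_div, mul_comm β]
          gcongr
          linarith [rpow_nonneg hκ.le β]
  · rw [Set.uIoc_of_le ht, Set.uIoc_of_le hκR]
    exact (hcont.continuousOn.integrableOn_compact
      (isCompact_Icc.prod isCompact_Icc)).mono_set
      (Set.prod_mono Set.Ioc_subset_Icc_self Set.Ioc_subset_Icc_self)

/-- Let `d ∈ {1,2,3}`, `α ∈ (0, 2/d)`, `θ ∈ (π/2, π)`, `c > 0`, and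
let `(λ_j)_{j≥1}` (here `lam j = λ_{j+1}`) be positive reals with `λ_j ≥ c j^{2/d}`.
With `S(r) := ∑_{j≥1} (r^α/(r^α+λ_j))²`, there is `C > 0` independent of `τ`, `t`, `κ`
such that for all `τ > 0`, `t ≥ τ`, `κ ∈ (0, 2/(t sin θ)]`:
`τ ∫₀^t [2 ∫_κ^{π/(τ sin θ)} S(r) e^{2sr cos θ} dr + κ ∫_{−θ}^{θ} S(κ) e^{2sκ cos ψ} dψ] ds
  ≤ C τ^{1−αd/2}`. -/
theorem stmt10 (d : ℕ) (hd : d = 1 ∨ d = 2 ∨ d = 3) (α θ c : ℝ)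
    (hα0 : 0 < α) (hαd : α < 2 / (d : ℝ)) (hθ : θ ∈ Set.Ioo (π / 2) π) (hc : 0 < c)
    (lam : ℕ → ℝ) (hpos : ∀ j, 0 < lam j)
    (hlow : ∀ j : ℕ, c * ((j : ℝ) + 1) ^ ((2 : ℝ) / (d : ℝ)) ≤ lam j) :
    ∃ C : ℝ, 0 < C ∧
      ∀ τ : ℝ, 0 < τ → ∀ t : ℝ, τ ≤ t → ∀ κ : ℝ, 0 < κ → κ ≤ 2 / (t * Real.sin θ) →
        τ * ∫ s in (0 : ℝ)..t,
          ((2 * ∫ r in κ..(π / (τ * Real.sin θ)),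
              (∑' j : ℕ, (r ^ α / (r ^ α + lam j)) ^ 2) * Real.exp (2 * s * r * Real.cos θ))
            + κ * ∫ ψ in (-θ)..θ,
              (∑' j : ℕ, (κ ^ α / (κ ^ α + lam j)) ^ 2) * Real.exp (2 * s * κ * Real.cos ψ)) ≤
          C * τ ^ (1 - α * (d : ℝ) / 2) := by
  obtain ⟨hθ1, hθ2⟩ := hθ
  have hd0 : 0 < (d : ℝ) := by rcases hd with h | h | h <;> simp [h]
  have hp : (1 : ℝ) / 2 < 2 / (d : ℝ) := by rcases hd with h | h | h <;> norm_num [h]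
  have hsin : 0 < Real.sin θ := sin_pos_of_pos_of_lt_pi (by linarith [pi_pos]) hθ2
  have hcos : Real.cos θ < 0 := cos_neg_of_pi_div_two_lt_of_lt hθ1 (by linarith [pi_pos])
  have hθ0 : 0 < θ := by linarith [pi_pos]
  obtain ⟨A, hA, hAS⟩ := exists_tsum_sq_le_mul hp hc hlow
  set β : ℝ := α * (d : ℝ) / 2 with hβdef
  have hβ : 0 < β := by positivity
  set S : ℝ → ℝ := fun r => ∑' j : ℕ, (r ^ α / (r ^ α + lam j)) ^ 2 with hS
  have hS0 : ∀ r, 0 ≤ S r := fun r => tsum_nonneg fun _ => sq_nonneg _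
  have hSle : ∀ r, 0 < r → S r ≤ A * r ^ β := by
    intro r hr
    have h := hAS (r ^ β) (rpow_pos_of_pos hr β)
    have hexp : β * (2 / (d : ℝ)) = α := by rw [hβdef]; field_simp
    rwa [← rpow_mul hr.le, hexp] at h
  set b : ℝ := -Real.cos θ with hbdef
  have hb : 0 < b := by linarith
  set σ : ℝ := Real.sin θ with hσ
  refine ⟨A * ((π / σ) ^ β / (b * β)) + A * (2 / σ) ^ β * (2 / σ) * (2 * θ * Real.exp (4 / σ)),
    by positivity, fun τ hτ t hτt κ hκ hκt => ?_⟩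
  have ht : 0 < t := hτ.trans_le hτt
  have hκτ : κ ≤ 2 / σ / τ := hκt.trans (by rw [div_div, mul_comm σ]; gcongr)
  have hR : π / (τ * σ) = π / σ / τ := by rw [div_div, mul_comm σ]
  have hκR : κ ≤ π / (τ * σ) := by
    rw [hR]
    exact hκτ.trans (by gcongr; exact two_le_pi)
  have hκt2 : κ * t ≤ 2 / σ := by
    calc κ * t ≤ 2 / (t * σ) * t := by gcongr
      _ = 2 / σ := by field_simp
  set R : ℝ := π / (τ * σ) with hRdef
  have hrpow : Continuous fun r : ℝ => r ^ β := continuous_id.rpow_const fun _ => Or.inr hβ.le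
  have hpar : Continuous fun s : ℝ => ∫ r in κ..R, r ^ β * Real.exp (2 * s * r * -b) := by
    refine continuous_parametric_intervalIntegral_of_continuous' ?_ _ _
    have : Continuous fun q : ℝ × ℝ => q.2 ^ β := hrpow.comp continuous_snd
    simp only [Function.uncurry_def]
    fun_prop
  set M : ℝ := κ * (2 * θ * (A * κ ^ β * Real.exp (4 / σ))) with hM
  have hcosb : Real.cos θ = -b := by rw [hbdef]; ring
  have hrays : ∀ s : ℝ, ∫ r in κ..R, S r * Real.exp (2 * s * r * Real.cos θ)
      ≤ A * ∫ r in κ..R, r ^ β * Real.exp (2 * s * r * -b) := by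
    intro s
    rw [hcosb, ← intervalIntegral.integral_const_mul]
    refine intervalIntegral_mono_of_nonneg hκR
      (fun r _ => mul_nonneg (hS0 r) (Real.exp_pos _).le) (fun r hr => ?_)
      (Continuous.intervalIntegrable (by fun_prop) _ _)
    rw [← mul_assoc]
    gcongr
    exact hSle r (hκ.trans hr.1)
  have harc : ∀ s ∈ Set.Ioc 0 t,
      κ * ∫ ψ in (-θ)..θ, S κ * Real.exp (2 * s * κ * Real.cos ψ) ≤ M := by
    intro s hs
    have h : ∫ ψ in (-θ)..θ, S κ * Real.exp (2 * s * κ * Real.cos ψ)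
        ≤ ∫ ψ in (-θ)..θ, A * κ ^ β * Real.exp (4 / σ) := by
      refine intervalIntegral_mono_of_nonneg (by linarith)
        (fun ψ _ => mul_nonneg (hS0 κ) (Real.exp_pos _).le) (fun ψ _ => ?_)
        intervalIntegrable_const
      have hs0 : 0 < s := hs.1
      have hexp : 2 * s * κ * Real.cos ψ ≤ 4 / σ := by
        calc 2 * s * κ * Real.cos ψ ≤ 2 * s * κ * 1 := by gcongr; exact cos_le_one ψ
          _ ≤ 2 * t * κ * 1 := by gcongr; exact hs.2
          _ = 2 * (κ * t) := by ring
          _ ≤ 2 * (2 / σ) := by gcongr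
          _ = 4 / σ := by ring
      gcongr
      exact hSle κ hκ
    rw [intervalIntegral.integral_const, smul_eq_mul] at h
    calc κ * ∫ ψ in (-θ)..θ, S κ * Real.exp (2 * s * κ * Real.cos ψ)
        ≤ κ * ((θ - -θ) * (A * κ ^ β * Real.exp (4 / σ))) := by gcongr
      _ = M := by rw [hM]; ring
  have hκβ : κ ^ β ≤ (2 / σ) ^ β * τ ^ (-β) := by
    calc κ ^ β ≤ (2 / σ / τ) ^ β := by gcongr
      _ = _ := by rw [div_rpow (by positivity) hτ.le, rpow_neg hτ.le, div_eq_mul_inv]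
  have hRβ : R ^ β = (π / σ) ^ β * τ ^ (-β) := by
    rw [hR, div_rpow (by positivity) hτ.le, rpow_neg hτ.le, div_eq_mul_inv]
  have hmain : ∫ s in (0 : ℝ)..t, ((2 * ∫ r in κ..R, S r * Real.exp (2 * s * r * Real.cos θ))
        + κ * ∫ ψ in (-θ)..θ, S κ * Real.exp (2 * s * κ * Real.cos ψ))
      ≤ (A * ((π / σ) ^ β / (b * β)) + A * (2 / σ) ^ β * (2 / σ) * (2 * θ * Real.exp (4 / σ)))
        * τ ^ (-β) := by
    calc _ ≤ ∫ s in (0 : ℝ)..t,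
          (2 * A * (∫ r in κ..R, r ^ β * Real.exp (2 * s * r * -b)) + M) := by
          refine intervalIntegral_mono_of_nonneg ht.le (fun s _ => ?_) (fun s hs => ?_)
            (Continuous.intervalIntegrable (by fun_prop) _ _)
          · have h1 : 0 ≤ ∫ r in κ..R, S r * Real.exp (2 * s * r * Real.cos θ) :=
              integral_nonneg hκR fun r _ => mul_nonneg (hS0 r) (Real.exp_pos _).le
            have h2 : 0 ≤ ∫ ψ in (-θ)..θ, S κ * Real.exp (2 * s * κ * Real.cos ψ) :=
              integral_nonneg (by linarith) fun ψ _ => mul_nonneg (hS0 κ) (Real.exp_pos _).le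
            positivity
          · have h1 := hrays s
            have h2 := harc s hs
            linarith
      _ = 2 * A * (∫ s in (0 : ℝ)..t, ∫ r in κ..R, r ^ β * Real.exp (2 * s * r * -b))
          + t * M := by
          rw [intervalIntegral.integral_add
            (Continuous.intervalIntegrable (by fun_prop) _ _) intervalIntegrable_const,
            intervalIntegral.integral_const_mul, intervalIntegral.integral_const,
            smul_eq_mul, sub_zero]
      _ ≤ 2 * A * (R ^ β / (2 * b * β))
          + (2 / σ) * (2 * θ * (A * ((2 / σ) ^ β * τ ^ (-β)) * Real.exp (4 / σ))) := by
          refine add_le_add ?_ ?_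
          · gcongr
            exact integral_integral_rpow_mul_exp_le hβ hb hκ hκR ht.le
          · calc t * M = κ * t * (2 * θ * (A * κ ^ β * Real.exp (4 / σ))) := by rw [hM]; ring
              _ ≤ _ := by gcongr
      _ = _ := by
          rw [hRβ]
          field_simp
  calc _ ≤ τ * ((A * ((π / σ) ^ β / (b * β))
        + A * (2 / σ) ^ β * (2 / σ) * (2 * θ * Real.exp (4 / σ))) * τ ^ (-β)) := by
        gcongr
    _ = _ := by
        rw [sub_eq_add_neg, rpow_add hτ, rpow_one]
        ring
end

section
/- Let d ∈ {1,2,3}, α ∈ (0, 2/d), c > 0, and let θ ∈ (π/2, π) satisfy αθ < π. Let (λ_j)_{j≥1} be positive reals with λ_j ≥ c j^{2/d} for all j ≥ 1. For τ > 0 set R = π/(τ sin θ), and for s > 0 and λ > 0 define H(s, λ) := (1/π) · Im ∫_R^∞ e^{s r e^{iθ}} (r e^{iθ})^{α−1} ((r e^{iθ})^α + λ)^{−1} e^{iθ} dr (the integral converges absolutely for s > 0 since cos θ < 0, and (re^{iθ})^α + λ ≠ 0 since αθ < π). Then there exists a constant C > 0, independent of τ and T, such that for all τ > 0 and all T > 0: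 ∫₀^T ∑_{j=1}^∞ H(s, λ_j)² ds ≤ C τ^{1 − α d/2}. -/
open Real MeasureTheory intervalIntegral

/-- The kernel `H(s, λ) = (1/π) Im ∫_R^∞ e^{s r e^{iθ}} (re^{iθ})^{α−1}
((re^{iθ})^α + λ)⁻¹ e^{iθ} dr`, i.e. the contribution of the two discarded rays
`{re^{±iθ} : r ≥ R}` of the sectorial contour (complex powers in the principal
branch). -/
noncomputable def Hker (α θ R s lmb : ℝ) : ℝ :=
  (1 / π) *
    (∫ r in Set.Ioi R,
      Complex.exp ((s : ℂ) * (r : ℂ) * Complex.exp ((θ : ℂ) * Complex.I)) *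
        ((r : ℂ) * Complex.exp ((θ : ℂ) * Complex.I)) ^ ((α : ℂ) - 1) *
        (((r : ℂ) * Complex.exp ((θ : ℂ) * Complex.I)) ^ (α : ℂ) + (lmb : ℂ))⁻¹ *
        Complex.exp ((θ : ℂ) * Complex.I)).im

open Set in
theorem lintegral_Ioi_ofReal_rpow {a R : ℝ} (ha : a < -1) (hR : 0 < R) :
    ∫⁻ r in Ioi R, ENNReal.ofReal (r ^ a) = ENNReal.ofReal (R ^ (a + 1) / (-(a + 1))) := by
  rw [← ofReal_integral_eq_lintegral_ofReal (integrableOn_Ioi_rpow_of_lt ha hR),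
    integral_Ioi_rpow_of_lt ha hR, neg_div, div_neg]
  filter_upwards [ae_restrict_mem measurableSet_Ioi] with r hr
  exact Real.rpow_nonneg (hR.trans hr).le a

open Set in
theorem lintegral_Ioi_zero_ofReal_exp {k : ℝ} (hk : 0 < k) :
    ∫⁻ s in Ioi (0 : ℝ), ENNReal.ofReal (Real.exp (-k * s)) = ENNReal.ofReal k⁻¹ := by
  have hk' : -k < 0 := neg_lt_zero.2 hk
  rw [← ofReal_integral_eq_lintegral_ofReal (integrableOn_exp_mul_Ioi hk' 0),
    integral_exp_mul_Ioi hk' 0]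
  · simp
  · exact Filter.Eventually.of_forall fun s => (Real.exp_pos _).le

/-- The Cauchy–Schwarz inequality for lower Lebesgue integrals. -/
theorem sq_lintegral_mul_le {Ω : Type*} [MeasurableSpace Ω] (μ : Measure Ω) {f g : Ω → ENNReal}
    (hf : AEMeasurable f μ) (hg : AEMeasurable g μ) :
    (∫⁻ x, f x * g x ∂μ) ^ 2 ≤ (∫⁻ x, f x ^ 2 ∂μ) * ∫⁻ x, g x ^ 2 ∂μ := by
  have h := ENNReal.lintegral_mul_le_Lp_mul_Lq μ Real.HolderConjugate.two_two hf hg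
  calc (∫⁻ x, f x * g x ∂μ) ^ 2
      ≤ ((∫⁻ x, f x ^ (2 : ℝ) ∂μ) ^ (1 / 2 : ℝ) * (∫⁻ x, g x ^ (2 : ℝ) ∂μ) ^ (1 / 2 : ℝ)) ^ 2 := by
        gcongr
        exact h
    _ = (∫⁻ x, f x ^ 2 ∂μ) * ∫⁻ x, g x ^ 2 ∂μ := by
        rw [mul_pow, ← ENNReal.rpow_natCast, ← ENNReal.rpow_natCast, ← ENNReal.rpow_mul,
          ← ENNReal.rpow_mul]
        norm_num

open Set in
/-- A sum of values of an antitone function at the positive integers is at most its integral. -/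
theorem tsum_natCast_succ_le_lintegral_Ioi {f : ℝ → ENNReal} (hf : AntitoneOn f (Ioi 0)) :
    ∑' j : ℕ, f (j + 1) ≤ ∫⁻ t in Ioi (0 : ℝ), f t := by
  calc ∑' j : ℕ, f (j + 1)
      ≤ ∑' j : ℕ, ∫⁻ t in Ioc (j : ℝ) ((j + 1 : ℕ) : ℝ), f t := by
        refine ENNReal.tsum_le_tsum fun j => ?_
        calc f (j + 1) = ∫⁻ _ in Ioc (j : ℝ) ((j + 1 : ℕ) : ℝ), f (j + 1) := by
              rw [setLIntegral_const]; simp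
          _ ≤ _ := by
              refine setLIntegral_mono' measurableSet_Ioc fun t ht => ?_
              have h0 : (0 : ℝ) < t := lt_of_le_of_lt (Nat.cast_nonneg j) ht.1
              refine hf h0 (by simp only [mem_Ioi]; positivity) ?_
              simpa using ht.2
    _ = ∫⁻ t in ⋃ j : ℕ, Ioc (j : ℝ) ((j + 1 : ℕ) : ℝ), f t := by
        rw [lintegral_iUnion (fun _ => measurableSet_Ioc)]
        exact (Nat.mono_cast (α := ℝ)).pairwise_disjoint_on_Ioc_succ
    _ ≤ _ := by
        refine lintegral_mono_set (iUnion_subset fun j t ht => ?_)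
        exact lt_of_le_of_lt (Nat.cast_nonneg j) ht.1

open Set in
theorem lintegral_Ioi_inv_add_rpow_sq_le {c p x : ℝ} (hc : 0 < c) (hp : 1 / 2 < p) (hx : 0 < x) :
    ∫⁻ t in Ioi (0 : ℝ), ENNReal.ofReal (((x + c * t ^ p) ^ 2)⁻¹) ≤
      ENNReal.ofReal ((1 + (c ^ 2)⁻¹ / (2 * p - 1)) * x ^ (1 / p - 2)) := by
  have hp0 : 0 < p := by linarith
  set u : ℝ := x ^ (1 / p) with hu
  have hu0 : 0 < u := Real.rpow_pos_of_pos hx _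
  have hnear : ∫⁻ t in Ioc 0 u, ENNReal.ofReal (((x + c * t ^ p) ^ 2)⁻¹) ≤
      ENNReal.ofReal (x ^ (1 / p - 2)) := by
    calc _ ≤ ∫⁻ _ in Ioc 0 u, ENNReal.ofReal ((x ^ 2)⁻¹) := by
          refine setLIntegral_mono' measurableSet_Ioc fun t ht => ENNReal.ofReal_le_ofReal ?_
          have := Real.rpow_nonneg ht.1.le p
          gcongr
          nlinarith
      _ = _ := by
          rw [setLIntegral_const, Real.volume_Ioc, ← ENNReal.ofReal_mul (by positivity), sub_zero,
            hu, Real.rpow_sub hx, Real.rpow_two, inv_mul_eq_div]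
  have hfar : ∫⁻ t in Ioi u, ENNReal.ofReal (((x + c * t ^ p) ^ 2)⁻¹) ≤
      ENNReal.ofReal ((c ^ 2)⁻¹ / (2 * p - 1) * x ^ (1 / p - 2)) := by
    calc _ ≤ ∫⁻ t in Ioi u, ENNReal.ofReal ((c ^ 2)⁻¹) * ENNReal.ofReal (t ^ (-(2 * p))) := by
          refine setLIntegral_mono' measurableSet_Ioi fun t ht => ?_
          have ht0 : 0 < t := hu0.trans ht
          rw [← ENNReal.ofReal_mul (by positivity)]
          refine ENNReal.ofReal_le_ofReal ?_
          have h1 : 0 < t ^ p := Real.rpow_pos_of_pos ht0 p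
          have h2 : (c ^ 2)⁻¹ * t ^ (-(2 * p)) = ((c * t ^ p) ^ 2)⁻¹ := by
            rw [Real.rpow_neg ht0.le, mul_comm 2 p, Real.rpow_mul ht0.le, mul_pow, mul_inv]
            norm_num
          rw [h2]
          gcongr
          linarith
      _ = _ := by
          rw [lintegral_const_mul' _ _ ENNReal.ofReal_ne_top,
            lintegral_Ioi_ofReal_rpow (by linarith) hu0, ← ENNReal.ofReal_mul (by positivity)]
          congr 1
          have h3 : u ^ (-(2 * p) + 1) = x ^ (1 / p - 2) := by
            rw [hu, ← Real.rpow_mul hx.le]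
            congr 1
            field_simp
            ring
          rw [h3, show -(-(2 * p) + 1) = 2 * p - 1 by ring]
          ring
  rw [← Ioc_union_Ioi_eq_Ioi hu0.le]
  have hp1 : 0 < 2 * p - 1 := by linarith
  refine (lintegral_union_le _ _ _).trans ((add_le_add hnear hfar).trans ?_)
  rw [← ENNReal.ofReal_add (by positivity) (by positivity)]
  apply le_of_eq
  ring_nf

theorem tsum_inv_add_sq_le {c p x : ℝ} (hc : 0 < c) (hp : 1 / 2 < p) (hx : 0 < x) {lam : ℕ → ℝ}
    (hlow : ∀ j : ℕ, c * ((j : ℝ) + 1) ^ p ≤ lam j) :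
    ∑' j, ENNReal.ofReal (((x + lam j) ^ 2)⁻¹) ≤
      ENNReal.ofReal ((1 + (c ^ 2)⁻¹ / (2 * p - 1)) * x ^ (1 / p - 2)) := by
  have hp0 : 0 < p := by linarith
  refine le_trans (ENNReal.tsum_le_tsum fun j => ?_)
    ((tsum_natCast_succ_le_lintegral_Ioi fun a ha b hb hab => ?_).trans
      (lintegral_Ioi_inv_add_rpow_sq_le hc hp hx))
  · refine ENNReal.ofReal_le_ofReal ?_
    gcongr
    exact hlow j
  · have ha' : 0 < a := ha
    refine ENNReal.ofReal_le_ofReal ?_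
    gcongr

theorem cos_half_mul_add_le_norm (a l φ : ℝ) :
    Real.cos (φ / 2) * (a + l) ≤ ‖(a : ℂ) * Complex.exp (φ * Complex.I) + l‖ := by
  refine le_of_abs_le (abs_le_of_sq_le_sq ?_ (norm_nonneg _))
  have h2 : Real.cos φ = 2 * Real.cos (φ / 2) ^ 2 - 1 := by
    rw [← Real.cos_two_mul]; ring_nf
  have hs := Real.sin_sq_add_cos_sq φ
  rw [← Complex.normSq_eq_norm_sq, Complex.normSq_apply]
  simp only [Complex.add_re, Complex.add_im, Complex.re_ofReal_mul, Complex.im_ofReal_mul,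
    Complex.exp_ofReal_mul_I_re, Complex.exp_ofReal_mul_I_im, Complex.ofReal_re,
    Complex.ofReal_im]
  have h3 : 0 ≤ (a - l) ^ 2 * (1 - Real.cos φ) :=
    mul_nonneg (sq_nonneg _) (by linarith [Real.cos_le_one φ])
  have h4 : (a * Real.cos φ + l) * (a * Real.cos φ + l) + (a * Real.sin φ + 0) * (a * Real.sin φ + 0)
      = a ^ 2 + l ^ 2 + 2 * a * l * Real.cos φ := by linear_combination a ^ 2 * hs
  have h5 : Real.cos (φ / 2) ^ 2 = (1 + Real.cos φ) / 2 := by linarith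
  rw [h4, mul_pow, h5]
  linarith

theorem ofReal_mul_exp_cpow {r θ : ℝ} (α : ℝ) (hr : 0 < r) (hθ : -π < θ) (hθ' : θ ≤ π) :
    ((r : ℂ) * Complex.exp (θ * Complex.I)) ^ (α : ℂ) =
      ((r ^ α : ℝ) : ℂ) * Complex.exp ((α * θ : ℝ) * Complex.I) := by
  have hne : (r : ℂ) * Complex.exp (θ * Complex.I) ≠ 0 :=
    mul_ne_zero (Complex.ofReal_ne_zero.2 hr.ne') (Complex.exp_ne_zero _)
  rw [Complex.cpow_def_of_ne_zero hne, Complex.log_ofReal_mul hr (Complex.exp_ne_zero _),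
    Complex.log_exp (by simpa using hθ) (by simpa using hθ'), Real.rpow_def_of_pos hr]
  push_cast
  rw [← Complex.exp_add]
  ring_nf

/-- The modulus of the integrand of `Hker` decays exponentially along the ray. -/
theorem norm_Hker_integrand_le {α θ r s l : ℝ} (hα : 0 < α) (hθ : θ ∈ Set.Ioo (π / 2) π)
    (hαθ : α * θ < π) (hr : 0 < r) (hl : 0 < l) :
    ‖Complex.exp ((s : ℂ) * (r : ℂ) * Complex.exp ((θ : ℂ) * Complex.I)) *
        ((r : ℂ) * Complex.exp ((θ : ℂ) * Complex.I)) ^ ((α : ℂ) - 1) *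
        (((r : ℂ) * Complex.exp ((θ : ℂ) * Complex.I)) ^ (α : ℂ) + (l : ℂ))⁻¹ *
        Complex.exp ((θ : ℂ) * Complex.I)‖ ≤
      Real.exp (s * r * Real.cos θ) * r ^ (α - 1) * (Real.cos (α * θ / 2) * (r ^ α + l))⁻¹ := by
  have hpi := Real.pi_pos
  have hθ0 : 0 < θ := by linarith [hθ.1]
  have hcos : 0 < Real.cos (α * θ / 2) :=
    Real.cos_pos_of_mem_Ioo ⟨by linarith [mul_pos hα hθ0], by linarith⟩
  have hrα := Real.rpow_pos_of_pos hr α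
  have h1 : ‖Complex.exp ((s : ℂ) * (r : ℂ) * Complex.exp ((θ : ℂ) * Complex.I))‖ =
      Real.exp (s * r * Real.cos θ) := by
    rw [Complex.norm_exp, ← Complex.ofReal_mul, Complex.re_ofReal_mul,
      Complex.exp_ofReal_mul_I_re]
  have h2 : ‖((r : ℂ) * Complex.exp ((θ : ℂ) * Complex.I)) ^ ((α : ℂ) - 1)‖ = r ^ (α - 1) := by
    rw [show (α : ℂ) - 1 = ((α - 1 : ℝ) : ℂ) by push_cast; ring, Complex.norm_cpow_real, norm_mul,
      Complex.norm_exp_ofReal_mul_I, mul_one, Complex.norm_real, Real.norm_of_nonneg hr.le]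
  rw [norm_mul, norm_mul, norm_mul, h1, h2, Complex.norm_exp_ofReal_mul_I, mul_one, norm_inv,
    ofReal_mul_exp_cpow α hr (by linarith) hθ.2.le]
  gcongr
  exact cos_half_mul_add_le_norm _ _ _


theorem enorm_Hker_sq_le {α θ R s l ε : ℝ} (hα : 0 < α) (hθ : θ ∈ Set.Ioo (π / 2) π)
    (hαθ : α * θ < π) (hR : 0 < R) (hl : 0 < l) (hε : 0 < ε) :
    ‖Hker α θ R s l ^ 2‖ₑ ≤
      ENNReal.ofReal (R ^ (-ε) / ε) * ∫⁻ r in Set.Ioi R, ENNReal.ofReal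
        ((Real.cos (α * θ / 2) ^ 2)⁻¹ * Real.exp (2 * s * r * Real.cos θ) *
          r ^ (2 * α - 1 + ε) * ((r ^ α + l) ^ 2)⁻¹) := by
  set K := Real.cos (α * θ / 2) with hK
  set w : ℝ → ENNReal := fun r => ENNReal.ofReal (r ^ (-(1 + ε) / 2)) with hw
  set h : ℝ → ENNReal := fun r => ENNReal.ofReal
    (K⁻¹ * Real.exp (s * r * Real.cos θ) * r ^ (α - 1 / 2 + ε / 2) * (r ^ α + l)⁻¹) with hh
  have hpi := Real.pi_pos
  have hθ0 : 0 < θ := by linarith [hθ.1]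
  have hK0 : 0 < K :=
    Real.cos_pos_of_mem_Ioo ⟨by linarith [mul_pos hα hθ0], by linarith⟩
  have hH : ‖Hker α θ R s l‖ₑ ≤ ∫⁻ r in Set.Ioi R, w r * h r := by
    have him : ∀ z : ℂ, ‖1 / π * z.im‖ₑ ≤ ‖z‖ₑ := fun z => by
      rw [← ofReal_norm, ← ofReal_norm]
      refine ENNReal.ofReal_le_ofReal ?_
      rw [norm_mul, Real.norm_of_nonneg (by positivity : 0 ≤ 1 / π)]
      calc 1 / π * ‖z.im‖ ≤ 1 * ‖z‖ := by
            gcongr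
            · rw [div_le_one hpi]; linarith [Real.pi_gt_three]
            · exact Complex.abs_im_le_norm z
        _ = ‖z‖ := one_mul _
    refine (him _).trans ((enorm_integral_le_lintegral_enorm _).trans
      (setLIntegral_mono' measurableSet_Ioi fun r hr => ?_))
    have hr0 : 0 < r := hR.trans hr
    rw [← ofReal_norm, hw, hh, ← ENNReal.ofReal_mul (by positivity)]
    refine ENNReal.ofReal_le_ofReal
      ((norm_Hker_integrand_le hα hθ hαθ hr0 hl).trans (le_of_eq ?_))
    rw [← hK, show α - 1 = -(1 + ε) / 2 + (α - 1 / 2 + ε / 2) by ring, Real.rpow_add hr0, mul_inv]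
    ring
  have hw2 : ∫⁻ r in Set.Ioi R, w r ^ 2 = ENNReal.ofReal (R ^ (-ε) / ε) := by
    have h1 : ∫⁻ r in Set.Ioi R, w r ^ 2 = ∫⁻ r in Set.Ioi R, ENNReal.ofReal (r ^ (-(1 + ε))) := by
      refine setLIntegral_congr_fun measurableSet_Ioi fun r hr => ?_
      have hr0 : 0 < r := hR.trans hr
      simp only [hw]
      rw [← ENNReal.ofReal_pow (by positivity), ← Real.rpow_mul_natCast hr0.le]
      congr 2
      push_cast
      ring
    rw [h1, lintegral_Ioi_ofReal_rpow (by linarith) hR]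
    ring_nf
  have hh2 : ∫⁻ r in Set.Ioi R, h r ^ 2 = ∫⁻ r in Set.Ioi R, ENNReal.ofReal
      ((K ^ 2)⁻¹ * Real.exp (2 * s * r * Real.cos θ) *
        r ^ (2 * α - 1 + ε) * ((r ^ α + l) ^ 2)⁻¹) := by
    refine setLIntegral_congr_fun measurableSet_Ioi fun r hr => ?_
    have hr0 : 0 < r := hR.trans hr
    simp only [hh]
    rw [← ENNReal.ofReal_pow (by positivity)]
    congr 1
    rw [mul_pow, mul_pow, mul_pow, inv_pow, inv_pow, ← Real.rpow_mul_natCast hr0.le,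
      ← Real.exp_nat_mul]
    push_cast
    ring_nf
  calc ‖Hker α θ R s l ^ 2‖ₑ = ‖Hker α θ R s l‖ₑ ^ 2 := enorm_pow _ _
    _ ≤ (∫⁻ r in Set.Ioi R, w r * h r) ^ 2 := by gcongr
    _ ≤ _ := sq_lintegral_mul_le _ (by fun_prop) (by fun_prop)
    _ = _ := by rw [hw2, hh2]

theorem tsum_enorm_Hker_sq_le {α θ R s c p ε : ℝ} {lam : ℕ → ℝ} (hα : 0 < α)
    (hθ : θ ∈ Set.Ioo (π / 2) π) (hαθ : α * θ < π) (hR : 0 < R) (hc : 0 < c) (hp : 1 / 2 < p)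
    (hε : 0 < ε) (hpos : ∀ j, 0 < lam j) (hlow : ∀ j : ℕ, c * ((j : ℝ) + 1) ^ p ≤ lam j) :
    ∑' j, ‖Hker α θ R s (lam j) ^ 2‖ₑ ≤
      ENNReal.ofReal (R ^ (-ε) / ε) * ∫⁻ r in Set.Ioi R,
        ENNReal.ofReal ((Real.cos (α * θ / 2) ^ 2)⁻¹ * (1 + (c ^ 2)⁻¹ / (2 * p - 1)) *
          r ^ (α / p - 1 + ε)) * ENNReal.ofReal (Real.exp (-(-2 * Real.cos θ * r) * s)) := by
  refine (ENNReal.tsum_le_tsum fun j => enorm_Hker_sq_le hα hθ hαθ hR (hpos j) hε).trans ?_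
  rw [ENNReal.tsum_mul_left, ← lintegral_tsum fun j => by fun_prop]
  refine mul_le_mul_right (setLIntegral_mono' measurableSet_Ioi fun r hr => ?_) _
  have hr0 : 0 < r := hR.trans hr
  have hp1 : 0 < 2 * p - 1 := by linarith
  have hp0 : 0 < p := by linarith
  have hsplit : ∀ j, ENNReal.ofReal ((Real.cos (α * θ / 2) ^ 2)⁻¹ *
      Real.exp (2 * s * r * Real.cos θ) * r ^ (2 * α - 1 + ε) * ((r ^ α + lam j) ^ 2)⁻¹) =
      ENNReal.ofReal ((Real.cos (α * θ / 2) ^ 2)⁻¹ *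
        Real.exp (2 * s * r * Real.cos θ) * r ^ (2 * α - 1 + ε)) *
        ENNReal.ofReal ((r ^ α + lam j) ^ 2)⁻¹ := fun j =>
    ENNReal.ofReal_mul (by positivity)
  simp_rw [hsplit]
  rw [ENNReal.tsum_mul_left]
  refine (mul_le_mul_right
    (tsum_inv_add_sq_le hc hp (Real.rpow_pos_of_pos hr0 α) hlow) _).trans (le_of_eq ?_)
  rw [← ENNReal.ofReal_mul (by positivity), ← ENNReal.ofReal_mul (by positivity)]
  congr 1
  have hpow : r ^ (α / p - 1 + ε) = r ^ (2 * α - 1 + ε) * (r ^ α) ^ (1 / p - 2) := by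
    rw [← Real.rpow_mul hr0.le, ← Real.rpow_add hr0]
    ring_nf
  have hexp : -(-2 * Real.cos θ * r) * s = 2 * s * r * Real.cos θ := by ring
  rw [hpow, hexp]
  ring

theorem lintegral_tsum_enorm_Hker_sq_le {α θ R c p : ℝ} {lam : ℕ → ℝ} (hα : 0 < α)
    (hθ : θ ∈ Set.Ioo (π / 2) π) (hαθ : α * θ < π) (hR : 0 < R) (hc : 0 < c) (hp : 1 / 2 < p)
    (hαp : α < p) (hpos : ∀ j, 0 < lam j) (hlow : ∀ j : ℕ, c * ((j : ℝ) + 1) ^ p ≤ lam j) :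
    ∫⁻ s in Set.Ioi (0 : ℝ), ∑' j, ‖Hker α θ R s (lam j) ^ 2‖ₑ ≤
      ENNReal.ofReal ((Real.cos (α * θ / 2) ^ 2)⁻¹ * (1 + (c ^ 2)⁻¹ / (2 * p - 1)) *
        (-2 * Real.cos θ)⁻¹ * (4 / (1 - α / p) ^ 2) * R ^ (α / p - 1)) := by
  have hp1 : 0 < 2 * p - 1 := by linarith
  have hp0 : 0 < p := by linarith
  have hβ : 0 < 1 - α / p := by rw [sub_pos, div_lt_one hp0]; exact hαp
  set ε := (1 - α / p) / 2 with hεdef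
  have hε : 0 < ε := by positivity
  have hβε : α / p = 1 - 2 * ε := by rw [hεdef]; ring
  set M := (Real.cos (α * θ / 2) ^ 2)⁻¹ * (1 + (c ^ 2)⁻¹ / (2 * p - 1)) with hM
  have hM0 : 0 ≤ M := by positivity
  have hcos : 0 < -2 * Real.cos θ := by
    have := Real.cos_neg_of_pi_div_two_lt_of_lt hθ.1 (by linarith [hθ.2, Real.pi_pos])
    linarith
  set κ := -2 * Real.cos θ with hκ
  calc _ ≤ ∫⁻ s in Set.Ioi (0 : ℝ), ENNReal.ofReal (R ^ (-ε) / ε) * ∫⁻ r in Set.Ioi R,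
        ENNReal.ofReal (M * r ^ (α / p - 1 + ε)) * ENNReal.ofReal (Real.exp (-(κ * r) * s)) :=
        lintegral_mono fun s => tsum_enorm_Hker_sq_le hα hθ hαθ hR hc hp hε hpos hlow
    _ = ENNReal.ofReal (R ^ (-ε) / ε) * ∫⁻ r in Set.Ioi R, ∫⁻ s in Set.Ioi (0 : ℝ),
        ENNReal.ofReal (M * r ^ (α / p - 1 + ε)) * ENNReal.ofReal (Real.exp (-(κ * r) * s)) := by
        rw [lintegral_const_mul' _ _ ENNReal.ofReal_ne_top, lintegral_lintegral_swap]
        fun_prop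
    _ = ENNReal.ofReal (R ^ (-ε) / ε) * ∫⁻ r in Set.Ioi R,
        ENNReal.ofReal (M * κ⁻¹) * ENNReal.ofReal (r ^ (-1 - ε)) := by
        congr 1
        refine setLIntegral_congr_fun measurableSet_Ioi fun r hr => ?_
        have hr0 : 0 < r := hR.trans hr
        rw [lintegral_const_mul' _ _ ENNReal.ofReal_ne_top,
          lintegral_Ioi_zero_ofReal_exp (mul_pos hcos hr0), ← ENNReal.ofReal_mul (by positivity),
          ← ENNReal.ofReal_mul (by positivity), hβε,
          show 1 - 2 * ε - 1 + ε = (-1 - ε) + 1 by ring, Real.rpow_add_one hr0.ne']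
        congr 1
        field_simp
    _ = _ := by
        rw [lintegral_const_mul' _ _ ENNReal.ofReal_ne_top,
          lintegral_Ioi_ofReal_rpow (by linarith) hR, ← ENNReal.ofReal_mul (by positivity),
          ← ENNReal.ofReal_mul (by positivity)]
        congr 1
        rw [hβε, show -1 - ε + 1 = -ε by ring, show 1 - 2 * ε - 1 = -ε + -ε by ring,
          Real.rpow_add hR]
        field_simp
        ring

/-- Let `d ∈ {1,2,3}`, `α ∈ (0, 2/d)`, `c > 0`, `θ ∈ (π/2, π)` with
`αθ < π`, and let `(λ_j)_{j≥1}` (here `lam j = λ_{j+1}`) be positive reals with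
`λ_j ≥ c j^{2/d}`. With `R = π/(τ sin θ)` and `H` as above, there is `C > 0`
independent of `τ` and `T` such that for all `τ > 0` and `T > 0`:
`∫₀^T ∑_{j≥1} H(s, λ_j)² ds ≤ C τ^{1−αd/2}`. -/
theorem stmt13 (d : ℕ) (hd : d = 1 ∨ d = 2 ∨ d = 3) (α θ c : ℝ)
    (hα0 : 0 < α) (hαd : α < 2 / (d : ℝ)) (hc : 0 < c)
    (hθ : θ ∈ Set.Ioo (π / 2) π) (hαθ : α * θ < π)
    (lam : ℕ → ℝ) (hpos : ∀ j, 0 < lam j)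
    (hlow : ∀ j : ℕ, c * ((j : ℝ) + 1) ^ ((2 : ℝ) / (d : ℝ)) ≤ lam j) :
    ∃ C : ℝ, 0 < C ∧ ∀ τ : ℝ, 0 < τ → ∀ T : ℝ, 0 < T →
      ∫ s in (0 : ℝ)..T, ∑' j : ℕ, (Hker α θ (π / (τ * Real.sin θ)) s (lam j)) ^ 2 ≤
        C * τ ^ (1 - α * (d : ℝ) / 2) := by
  have hd0 : (0 : ℝ) < d := by rcases hd with rfl | rfl | rfl <;> norm_num
  have hp : (1 : ℝ) / 2 < 2 / d := by rcases hd with rfl | rfl | rfl <;> norm_num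
  have hsin : 0 < Real.sin θ :=
    Real.sin_pos_of_pos_of_lt_pi (by linarith [hθ.1, Real.pi_pos]) hθ.2
  set p : ℝ := 2 / d with hpdef
  set A : ℝ := (Real.cos (α * θ / 2) ^ 2)⁻¹ * (1 + (c ^ 2)⁻¹ / (2 * p - 1)) *
    (-2 * Real.cos θ)⁻¹ * (4 / (1 - α / p) ^ 2) with hA
  set B : ℝ := A * (π / Real.sin θ) ^ (α / p - 1) with hB
  refine ⟨|B| + 1, by positivity, fun τ hτ T hT => ?_⟩
  have hR : 0 < π / (τ * Real.sin θ) := by positivity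
  have key := lintegral_tsum_enorm_Hker_sq_le hα0 hθ hαθ hR hc hp hαd hpos hlow
  rw [← hA] at key
  have hscale : A * (π / (τ * Real.sin θ)) ^ (α / p - 1) = B * τ ^ (1 - α * (d : ℝ) / 2) := by
    have hexp : 1 - α * (d : ℝ) / 2 = -(α / p - 1) := by rw [hpdef]; field_simp; ring
    rw [hexp, Real.rpow_neg hτ.le, show π / (τ * Real.sin θ) = π / Real.sin θ / τ by field_simp,
      Real.div_rpow (by positivity) hτ.le, hB]
    ring
  rw [hscale] at key
  have hle : B * τ ^ (1 - α * (d : ℝ) / 2) ≤ (|B| + 1) * τ ^ (1 - α * (d : ℝ) / 2) := by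
    gcongr
    linarith [le_abs_self B]
  rw [intervalIntegral.integral_of_le hT.le]
  refine (le_abs_self _).trans ((ENNReal.ofReal_le_ofReal_iff (by positivity)).1 ?_)
  rw [← Real.norm_eq_abs, ofReal_norm]
  calc _ ≤ ∫⁻ s in Set.Ioc 0 T, ‖∑' j, Hker α θ (π / (τ * Real.sin θ)) s (lam j) ^ 2‖ₑ :=
        enorm_integral_le_lintegral_enorm _
    _ ≤ ∫⁻ s in Set.Ioc 0 T, ∑' j, ‖Hker α θ (π / (τ * Real.sin θ)) s (lam j) ^ 2‖ₑ :=
        lintegral_mono fun s => enorm_tsum_le_tsum_enorm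
    _ ≤ ∫⁻ s in Set.Ioi (0 : ℝ), ∑' j, ‖Hker α θ (π / (τ * Real.sin θ)) s (lam j) ^ 2‖ₑ :=
        lintegral_mono_set Set.Ioc_subset_Ioi_self
    _ ≤ _ := key.trans (ENNReal.ofReal_le_ofReal hle)
end
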